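/- Let X = X_u × X_n with nominal structure R₀, Q₀, utility U : X → ℝ, and fix x° ∈ X. Suppose a family {h*_ζ : ζ ∈ ℝ} of functions on X and {η*(ζ) : ζ ∈ ℝ} satisfy: (a) ζ U(x) + Λ_{h*_ζ}(x) = h*_ζ(x) + η*(ζ) for all x, ζ (the average-reward optimality fixed-point equation); (b) h*_ζ(x°) = 0 for all ζ; (c) ζ ↦ h*_ζ and ζ ↦ η*(ζ) are differentiable; (d) each tilted matrix \check{P}_ζ := P_{h*_ζ} is primitive with invariant pmf \check{π}_ζ. Then the family solves the ordinary differential equation (d/dζ) h*_ζ = 𝓗°(\check{P}_ζ), where for a primitive stochastic matrix P with invariant pmf π and fundamental matrix Z = (I − P + 1⊗π)^{-1}, 𝓗°(P)(x) := Σ_{x'} ( Z(x,x') − Z(x°,x') ) U(x'). -/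

import Mathlib

/-- Conditional average `h(xu'∣x) = ∑_{xn'} Q₀(x,xn') h(xu',xn')`. -/
noncomputable def condAvg {Xu Xn : Type*} [Fintype Xn]
    (Q₀ : (Xu × Xn) → Xn → ℝ) (h : Xu × Xn → ℝ) (x : Xu × Xn) (xu' : Xu) : ℝ :=
  ∑ xn', Q₀ x xn' * h (xu', xn')

/-- Log-partition function `Λ_h(x) = log ∑_{xu'} R₀(x,xu') exp(h(xu'∣x))`. -/
noncomputable def logPart {Xu Xn : Type*} [Fintype Xu] [Fintype Xn]
    (R₀ : (Xu × Xn) → Xu → ℝ) (Q₀ : (Xu × Xn) → Xn → ℝ)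
    (h : Xu × Xn → ℝ) (x : Xu × Xn) : ℝ :=
  Real.log (∑ xu', R₀ x xu' * Real.exp (condAvg Q₀ h x xu'))

/-- Tilted matrix `P_h(x,(xu',xn')) = R₀(x,xu') exp(h(xu'∣x) − Λ_h(x)) Q₀(x,xn')`. -/
noncomputable def tilt {Xu Xn : Type*} [Fintype Xu] [Fintype Xn]
    (R₀ : (Xu × Xn) → Xu → ℝ) (Q₀ : (Xu × Xn) → Xn → ℝ)
    (h : Xu × Xn → ℝ) (x x' : Xu × Xn) : ℝ :=
  R₀ x x'.1 * Real.exp (condAvg Q₀ h x x'.1 - logPart R₀ Q₀ h x) * Q₀ x x'.2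

/-- The functional `𝓗°(P)(x) = ∑_{x'} (Z(x,x') − Z(x°,x')) U(x')`, where
`Z = (I − P + 1⊗π)⁻¹` is the fundamental matrix of `P` with invariant pmf `π`. -/
noncomputable def fishFn {X : Type*} [Fintype X] [DecidableEq X]
    (P : Matrix X X ℝ) (π : X → ℝ) (U : X → ℝ) (x₀ x : X) : ℝ :=
  ∑ x', (((1 - P + Matrix.of fun (_ : X) x' => π x')⁻¹) x x'
        - ((1 - P + Matrix.of fun (_ : X) x' => π x')⁻¹) x₀ x') * U x'

open Matrix in
/-- A fixed vector of a strictly positive row-stochastic matrix is constant. -/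
theorem eq_of_mulVec_eq_of_pos {X : Type*} [Fintype X] {B : Matrix X X ℝ}
    (hpos : ∀ x y, 0 < B x y) (hsum : B *ᵥ 1 = 1) {v : X → ℝ} (hv : B *ᵥ v = v) (x y : X) :
    v x = v y := by
  have : Nonempty X := ⟨x⟩
  obtain ⟨m, hm⟩ := Finite.exists_max v
  have hrow : ∑ z, B m z = 1 := by simpa [mulVec, dotProduct] using congrFun hsum m
  have hfix : ∑ z, B m z * v z = v m := congrFun hv m
  have hzero : ∑ z, B m z * (v m - v z) = 0 := by
    simp only [mul_sub, Finset.sum_sub_distrib, ← Finset.sum_mul, hrow, hfix]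
    ring
  have hterm : ∀ z, v z = v m := fun z => by
    have h0 := (Finset.sum_eq_zero_iff_of_nonneg fun z _ =>
      mul_nonneg (hpos m z).le (sub_nonneg.2 (hm z))).1 hzero z (Finset.mem_univ z)
    have := (mul_eq_zero.1 h0).resolve_left (hpos m z).ne'
    linarith
  rw [hterm x, hterm y]

open Matrix in
theorem pow_mulVec_eq_of_mulVec_eq {X : Type*} [Fintype X] [DecidableEq X] {P : Matrix X X ℝ}
    {v : X → ℝ} (hv : P *ᵥ v = v) (n : ℕ) : P ^ n *ᵥ v = v := by
  induction n with
  | zero => simp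
  | succ n ih => rw [pow_succ, ← mulVec_mulVec, hv, ih]

open Matrix in
theorem fundamental_mulVec {X : Type*} [Fintype X] [DecidableEq X] (P : Matrix X X ℝ)
    (π v : X → ℝ) (x : X) :
    ((1 - P + Matrix.of fun (_ : X) x' => π x') *ᵥ v) x = v x - (P *ᵥ v) x + π ⬝ᵥ v := by
  simp [add_mulVec, sub_mulVec]
  rfl

open Matrix in
/-- The matrix `I − P + 1⊗π` is invertible for a primitive stochastic `P` with invariant `π`. -/
theorem isUnit_fundamental {X : Type*} [Fintype X] [DecidableEq X] {P : Matrix X X ℝ}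
    {π : X → ℝ} (hP : P *ᵥ 1 = 1) {n : ℕ} (hprim : ∀ x y, 0 < (P ^ n) x y)
    (hπ : ∑ x, π x = 1) (hinv : π ᵥ* P = π) :
    IsUnit (1 - P + Matrix.of fun (_ : X) x' => π x') := by
  rw [← mulVec_injective_iff_isUnit]
  refine (injective_iff_map_eq_zero (mulVecLin _)).2 fun v hv => ?_
  have hx : ∀ x, v x - (P *ᵥ v) x + π ⬝ᵥ v = 0 := fun x => by
    rw [← fundamental_mulVec]
    exact congrFun hv x
  have hπv : π ⬝ᵥ v = 0 := by
    have hsum : ∑ x, π x * (v x - (P *ᵥ v) x + π ⬝ᵥ v) = 0 :=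
      Finset.sum_eq_zero fun x _ => by rw [hx x, mul_zero]
    have hπP : ∑ x, π x * (P *ᵥ v) x = π ⬝ᵥ v := by
      change π ⬝ᵥ (P *ᵥ v) = _
      rw [dotProduct_mulVec, hinv]
    simp only [mul_add, mul_sub, Finset.sum_add_distrib, Finset.sum_sub_distrib, hπP,
      ← Finset.sum_mul, hπ] at hsum
    change π ⬝ᵥ v - _ + _ = 0 at hsum
    linarith
  have hPv : P *ᵥ v = v := funext fun x => by linarith [hx x]
  have hconst := eq_of_mulVec_eq_of_pos hprim (pow_mulVec_eq_of_mulVec_eq hP n)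
    (pow_mulVec_eq_of_mulVec_eq hPv n)
  funext x
  have : π ⬝ᵥ v = v x := by
    simp only [dotProduct, hconst _ x, ← Finset.sum_mul, hπ, one_mul]
  rw [← this, hπv, Pi.zero_apply]

open Matrix in
/-- A solution of Poisson's equation is given, up to a constant, by the fundamental matrix. -/
theorem fishFn_eq_of_poisson {X : Type*} [Fintype X] [DecidableEq X] {P : Matrix X X ℝ}
    {π : X → ℝ} (hP : P *ᵥ 1 = 1) {n : ℕ} (hprim : ∀ x y, 0 < (P ^ n) x y)
    (hπ : ∑ x, π x = 1) (hinv : π ᵥ* P = π) {U H : X → ℝ} {c : ℝ}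
    (hH : ∀ x, U x + (P *ᵥ H) x = H x + c) (x₀ x : X) :
    fishFn P π U x₀ x = H x - H x₀ := by
  have hunit := (isUnit_iff_isUnit_det _).1 (isUnit_fundamental hP hprim hπ hinv)
  set A := 1 - P + Matrix.of fun (_ : X) x' => π x' with hA
  have hU : A *ᵥ (H + (c - π ⬝ᵥ H) • 1) = U := by
    funext y
    have h1 : (A *ᵥ 1) y = 1 := by
      rw [hA, fundamental_mulVec, hP, dotProduct_one, hπ]
      simp
    rw [mulVec_add, mulVec_smul, Pi.add_apply, Pi.smul_apply, h1, hA, fundamental_mulVec]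
    simp only [smul_eq_mul]
    linarith [hH y]
  have hZ : A⁻¹ *ᵥ U = H + (c - π ⬝ᵥ H) • 1 := by
    rw [← hU, mulVec_mulVec, nonsing_inv_mul _ hunit, one_mulVec]
  have hfish : fishFn P π U x₀ x = (A⁻¹ *ᵥ U) x - (A⁻¹ *ᵥ U) x₀ := by
    simp only [fishFn, sub_mul, Finset.sum_sub_distrib]
    rfl
  rw [hfish, hZ]
  simp

section Tilt

variable {Xu Xn : Type*} [Fintype Xu] [Fintype Xn] {R₀ : (Xu × Xn) → Xu → ℝ}

theorem sum_mul_exp_condAvg_pos [Nonempty Xu] (hR₀pos : ∀ x xu', 0 < R₀ x xu')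
    (Q₀ : (Xu × Xn) → Xn → ℝ) (h : Xu × Xn → ℝ) (x : Xu × Xn) :
    0 < ∑ xu', R₀ x xu' * Real.exp (condAvg Q₀ h x xu') :=
  Finset.sum_pos (fun _ _ => mul_pos (hR₀pos _ _) (Real.exp_pos _)) Finset.univ_nonempty

theorem sum_tilt_mul [Nonempty Xu] (hR₀pos : ∀ x xu', 0 < R₀ x xu')
    (Q₀ : (Xu × Xn) → Xn → ℝ) (h g : Xu × Xn → ℝ) (x : Xu × Xn) :
    ∑ x', tilt R₀ Q₀ h x x' * g x' =
      (∑ xu', R₀ x xu' * (Real.exp (condAvg Q₀ h x xu') * condAvg Q₀ g x xu')) /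
        ∑ xu', R₀ x xu' * Real.exp (condAvg Q₀ h x xu') := by
  rw [Fintype.sum_prod_type, Finset.sum_div]
  refine Finset.sum_congr rfl fun xu' _ => ?_
  rw [condAvg.eq_def Q₀ g, Finset.mul_sum, Finset.mul_sum, Finset.sum_div]
  refine Finset.sum_congr rfl fun xn' _ => ?_
  rw [tilt, logPart, Real.exp_sub, Real.exp_log (sum_mul_exp_condAvg_pos hR₀pos Q₀ h x)]
  ring

theorem sum_tilt [Nonempty Xu] (hR₀pos : ∀ x xu', 0 < R₀ x xu') {Q₀ : (Xu × Xn) → Xn → ℝ}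
    (hQ₀sum : ∀ x, ∑ xn', Q₀ x xn' = 1) (h : Xu × Xn → ℝ) (x : Xu × Xn) :
    ∑ x', tilt R₀ Q₀ h x x' = 1 := by
  have hone := sum_tilt_mul hR₀pos Q₀ h 1 x
  simp only [condAvg.eq_def Q₀ 1, Pi.one_apply, mul_one, hQ₀sum] at hone
  rw [hone, div_self (sum_mul_exp_condAvg_pos hR₀pos Q₀ h x).ne']

/-- The derivative of the log-partition function is the tilted matrix. -/
theorem hasDerivAt_logPart [Nonempty Xu] (hR₀pos : ∀ x xu', 0 < R₀ x xu')
    (Q₀ : (Xu × Xn) → Xn → ℝ) {h : ℝ → Xu × Xn → ℝ} {h' : Xu × Xn → ℝ} {ζ : ℝ}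
    (hh : ∀ x, HasDerivAt (fun ζ => h ζ x) (h' x) ζ) (x : Xu × Xn) :
    HasDerivAt (fun ζ => logPart R₀ Q₀ (h ζ) x) (∑ x', tilt R₀ Q₀ (h ζ) x x' * h' x') ζ := by
  rw [sum_tilt_mul hR₀pos]
  have hcond : ∀ xu', HasDerivAt (fun ζ => condAvg Q₀ (h ζ) x xu') (condAvg Q₀ h' x xu') ζ :=
    fun xu' => HasDerivAt.fun_sum fun xn' _ => (hh (xu', xn')).const_mul (Q₀ x xn')
  exact (HasDerivAt.fun_sum fun xu' _ => (hcond xu').exp.const_mul (R₀ x xu')).log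
    (sum_mul_exp_condAvg_pos hR₀pos Q₀ (h ζ) x).ne'

end Tilt

/-- Suppose `{h*_ζ}` and `{η*(ζ)}` satisfy the average-reward
fixed point equation `ζU + Λ_{h*_ζ} = h*_ζ + η*(ζ)`, the normalization
`h*_ζ(x°) = 0`, differentiability in `ζ`, and primitivity of each tilted
matrix `P̌_ζ = P_{h*_ζ}` (with invariant pmf `π̌_ζ`).  Then the family solves
the ODE `(d/dζ) h*_ζ = 𝓗°(P̌_ζ)`. -/
theorem relative_value_ode
    {Xu Xn : Type*} [Fintype Xu] [Fintype Xn] [Nonempty Xu] [Nonempty Xn]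
    [DecidableEq Xu] [DecidableEq Xn]
    (R₀ : (Xu × Xn) → Xu → ℝ)
    (hR₀pos : ∀ x xu', 0 < R₀ x xu') (hR₀sum : ∀ x, ∑ xu', R₀ x xu' = 1)
    (Q₀ : (Xu × Xn) → Xn → ℝ)
    (hQ₀ : ∀ x xn', 0 ≤ Q₀ x xn') (hQ₀sum : ∀ x, ∑ xn', Q₀ x xn' = 1)
    (U : Xu × Xn → ℝ) (x₀ : Xu × Xn)
    (h : ℝ → (Xu × Xn) → ℝ) (η : ℝ → ℝ) (π : ℝ → (Xu × Xn) → ℝ)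
    -- (a) the average-reward optimality fixed-point equation
    (ha : ∀ (ζ : ℝ) (x : Xu × Xn),
      ζ * U x + logPart R₀ Q₀ (h ζ) x = h ζ x + η ζ)
    -- (b) normalization
    (hb : ∀ ζ : ℝ, h ζ x₀ = 0)
    -- (c) differentiability in ζ
    (hc : ∀ x, Differentiable ℝ (fun ζ : ℝ => h ζ x))
    (hcη : Differentiable ℝ η)
    -- (d) primitivity of each tilted matrix, with invariant pmf π̌_ζ
    (hdprim : ∀ ζ : ℝ, ∃ n : ℕ, 1 ≤ n ∧
      ∀ x x', 0 < ((Matrix.of (tilt R₀ Q₀ (h ζ)) : Matrix (Xu × Xn) (Xu × Xn) ℝ) ^ n) x x')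
    (hdπnn : ∀ (ζ : ℝ) (x : Xu × Xn), 0 ≤ π ζ x)
    (hdπsum : ∀ ζ : ℝ, ∑ x, π ζ x = 1)
    (hdπinv : ∀ (ζ : ℝ) (x' : Xu × Xn), ∑ x, π ζ x * tilt R₀ Q₀ (h ζ) x x' = π ζ x') :
    ∀ (ζ : ℝ) (x : Xu × Xn),
      HasDerivAt (fun ζ : ℝ => h ζ x)
        (fishFn (Matrix.of (tilt R₀ Q₀ (h ζ))) (π ζ) U x₀ x) ζ := by
  intro ζ x
  have hderiv : ∀ y, HasDerivAt (fun ζ => h ζ y) (deriv (fun ζ => h ζ y) ζ) ζ :=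
    fun y => (hc y ζ).hasDerivAt
  have hpoisson : ∀ y, U y + (Matrix.mulVec (Matrix.of (tilt R₀ Q₀ (h ζ)))
      fun y => deriv (fun ζ => h ζ y) ζ) y = deriv (fun ζ => h ζ y) ζ + deriv η ζ := fun y => by
    have hleft := ((hasDerivAt_id ζ).mul_const (U y)).fun_add
      (hasDerivAt_logPart hR₀pos Q₀ hderiv y)
    have hright := (hderiv y).fun_add (hcη ζ).hasDerivAt
    have heq := hleft.unique (hright.congr_of_eventuallyEq (.of_forall fun ζ => ha ζ y))
    rwa [one_mul] at heq
  obtain ⟨n, -, hprim⟩ := hdprim ζ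
  have hstoch : Matrix.mulVec (Matrix.of (tilt R₀ Q₀ (h ζ))) 1 = 1 := funext fun y => by
    simpa [Matrix.mulVec, dotProduct] using sum_tilt hR₀pos hQ₀sum (h ζ) y
  have hfish := fishFn_eq_of_poisson hstoch hprim (hdπsum ζ) (funext (hdπinv ζ)) hpoisson x₀ x
  simp only [hb, deriv_const, sub_zero] at hfish
  rw [hfish]
  exact hderiv x
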